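/- Smooth functions η_t, η_s, η₁, …, η_{n₀} : ℝ^{n₀} × ℝ³ → ℝ satisfy the system ∂η_t/∂t = 0, ∂η_t/∂s = 0, ∂η_t/∂xⁱ = 0 and ∂η_i/∂t = 0 for all i = 1,…,n₀, ∂η_s/∂t = 2 η_t, and ∂η_i/∂s − ∂η_s/∂xⁱ = −2 η_i for all i, if and only if there exist a smooth function f₁ : ℝ → ℝ, a smooth function f₂ : ℝ^{n₀} × ℝ² → ℝ, and smooth functions h_i : ℝ^{n₀} × ℝ² → ℝ (i = 1,…,n₀) satisfying the ordinary differential equations ∂h_i/∂s + 2 h_i = ∂f₂/∂xⁱ, such that η_t(x,t,s,u) = f₁(u), η_s(x,t,s,u) = 2 t f₁(u) + f₂(x,s,u), and η_i(x,t,s,u) = h_i(x,s,u) for all (x,t,s,u). -/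

import Mathlib

/-- A differentiable function whose derivative in the direction `v` is the constant `c` along the
line `p + ℝ v` is affine along that line. -/
theorem eq_add_mul_of_fderiv_line {E : Type*} [NormedAddCommGroup E] [NormedSpace ℝ E]
    {f : E → ℝ} (hf : Differentiable ℝ f) (p v : E) (c : ℝ)
    (hc : ∀ r : ℝ, fderiv ℝ f (p + r • v) v = c) (r : ℝ) :
    f (p + r • v) = f p + r * c := by
  have hline : ∀ r : ℝ, HasDerivAt (fun r : ℝ => p + r • v) v r := fun r => by
    simpa using ((hasDerivAt_id r).smul_const v).const_add p
  have hg : ∀ r : ℝ, HasDerivAt (fun r : ℝ => f (p + r • v) - r * c) 0 r := fun r => by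
    have h := ((hf (p + r • v)).hasFDerivAt.comp_hasDerivAt r (hline r)).sub
      ((hasDerivAt_id r).mul_const c)
    rw [hc r, one_mul, sub_self] at h
    exact h
  have h := is_const_of_deriv_eq_zero (fun r => (hg r).differentiableAt)
    (fun r => (hg r).deriv) r 0
  simp only [zero_smul, add_zero, zero_mul, sub_zero] at h
  linarith

/-- The chain rule for precomposition with a continuous linear map, evaluated at a vector. -/
theorem fderiv_comp_clm_apply {E F : Type*} [NormedAddCommGroup E] [NormedSpace ℝ E]
    [NormedAddCommGroup F] [NormedSpace ℝ F] {f : F → ℝ} (hf : Differentiable ℝ f)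
    (L : E →L[ℝ] F) (q w : E) :
    fderiv ℝ (fun y => f (L y)) q w = fderiv ℝ f (L q) (L w) := by
  have h : HasFDerivAt (fun y => f (L y)) ((fderiv ℝ f (L q)).comp L) q :=
    (hf (L q)).hasFDerivAt.comp q L.hasFDerivAt
  rw [h.fderiv, ContinuousLinearMap.comp_apply]

/-- The inclusion `(x, s, u) ↦ (x, 0, s, u)`. -/
def zeroTimeInclusion (X : Type*) [NormedAddCommGroup X] [NormedSpace ℝ X] :
    (X × ℝ × ℝ) →L[ℝ] (X × ℝ × ℝ × ℝ) :=
  (ContinuousLinearMap.fst ℝ X (ℝ × ℝ)).prod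
    ((0 : (X × ℝ × ℝ) →L[ℝ] ℝ).prod (ContinuousLinearMap.snd ℝ X (ℝ × ℝ)))

/-- The projection `(x, t, s, u) ↦ (x, s, u)`. -/
def forgetTime (X : Type*) [NormedAddCommGroup X] [NormedSpace ℝ X] :
    (X × ℝ × ℝ × ℝ) →L[ℝ] (X × ℝ × ℝ) :=
  (ContinuousLinearMap.fst ℝ X (ℝ × ℝ × ℝ)).prod
    ((ContinuousLinearMap.snd ℝ ℝ (ℝ × ℝ)).comp (ContinuousLinearMap.snd ℝ X (ℝ × ℝ × ℝ)))

/-- The projection `(x, t, s, u) ↦ t`. -/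
def timeCoord (X : Type*) [NormedAddCommGroup X] [NormedSpace ℝ X] :
    (X × ℝ × ℝ × ℝ) →L[ℝ] ℝ :=
  (ContinuousLinearMap.fst ℝ ℝ (ℝ × ℝ)).comp (ContinuousLinearMap.snd ℝ X (ℝ × ℝ × ℝ))

/-- The projection `(x, t, s, u) ↦ u`. -/
def lastCoord (X : Type*) [NormedAddCommGroup X] [NormedSpace ℝ X] :
    (X × ℝ × ℝ × ℝ) →L[ℝ] ℝ :=
  (ContinuousLinearMap.snd ℝ ℝ ℝ).comp ((ContinuousLinearMap.snd ℝ ℝ (ℝ × ℝ)).comp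
    (ContinuousLinearMap.snd ℝ X (ℝ × ℝ × ℝ)))

/-- The inclusion `u ↦ (0, 0, 0, u)`. -/
def lastInclusion (X : Type*) [NormedAddCommGroup X] [NormedSpace ℝ X] :
    ℝ →L[ℝ] (X × ℝ × ℝ × ℝ) :=
  (0 : ℝ →L[ℝ] X).prod ((0 : ℝ →L[ℝ] ℝ).prod ((0 : ℝ →L[ℝ] ℝ).prod (ContinuousLinearMap.id ℝ ℝ)))

/-- A linear functional vanishing on the coordinate directions of `x`, `t` and `s` vanishes on
every `(x, t, s, 0)`. -/
theorem apply_eq_zero_of_coordinates {n : ℕ} (A : ((Fin n → ℝ) × ℝ × ℝ × ℝ) →L[ℝ] ℝ)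
    (ht : A (0, 1, 0, 0) = 0) (hs : A (0, 0, 1, 0) = 0)
    (hx : ∀ i, A (Pi.single i 1, 0, 0, 0) = 0) (x : Fin n → ℝ) (t s : ℝ) :
    A (x, t, s, 0) = 0 := by
  have hx' : A (x, 0, 0, 0) = 0 := by
    have h : (A.comp (ContinuousLinearMap.inl ℝ (Fin n → ℝ) (ℝ × ℝ × ℝ))).toLinearMap = 0 :=
      LinearMap.pi_ext' fun i => LinearMap.ext_ring (hx i)
    exact LinearMap.congr_fun h x
  have hsum : ((x, t, s, 0) : (Fin n → ℝ) × ℝ × ℝ × ℝ)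
      = (x, 0, 0, 0) + t • (0, 1, 0, 0) + s • (0, 0, 1, 0) := by
    simp
  rw [hsum, map_add, map_add, map_smul, map_smul, hx', ht, hs]
  simp

/-- Smooth functions `η_t, η_s, η_1, …, η_{n₀}` on `ℝ^{n₀} × ℝ³`
(points written `(x,t,s,u)`) satisfy the system
`∂η_t/∂t = ∂η_t/∂s = ∂η_t/∂xⁱ = 0`, `∂η_i/∂t = 0`, `∂η_s/∂t = 2η_t`, and
`∂η_i/∂s − ∂η_s/∂xⁱ = −2η_i`, if and only if there exist smooth functions
`f₁ : ℝ → ℝ`, `f₂ : ℝ^{n₀} × ℝ² → ℝ` and `h_i : ℝ^{n₀} × ℝ² → ℝ` with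
`∂h_i/∂s + 2h_i = ∂f₂/∂xⁱ`, such that `η_t(x,t,s,u) = f₁(u)`,
`η_s(x,t,s,u) = 2t·f₁(u) + f₂(x,s,u)` and `η_i(x,t,s,u) = h_i(x,s,u)`. -/
theorem stmt17 (n₀ : ℕ)
    (ηt ηs : ((Fin n₀ → ℝ) × ℝ × ℝ × ℝ) → ℝ)
    (ηx : Fin n₀ → ((Fin n₀ → ℝ) × ℝ × ℝ × ℝ) → ℝ)
    (hηt : ContDiff ℝ (⊤ : ℕ∞) ηt) (hηs : ContDiff ℝ (⊤ : ℕ∞) ηs)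
    (hηx : ∀ i, ContDiff ℝ (⊤ : ℕ∞) (ηx i)) :
    ((∀ p, fderiv ℝ ηt p (0, 1, 0, 0) = 0) ∧
     (∀ p, fderiv ℝ ηt p (0, 0, 1, 0) = 0) ∧
     (∀ (i : Fin n₀) p, fderiv ℝ ηt p (Pi.single i 1, 0, 0, 0) = 0) ∧
     (∀ (i : Fin n₀) p, fderiv ℝ (ηx i) p (0, 1, 0, 0) = 0) ∧
     (∀ p, fderiv ℝ ηs p (0, 1, 0, 0) = 2 * ηt p) ∧
     (∀ (i : Fin n₀) p,
       fderiv ℝ (ηx i) p (0, 0, 1, 0) - fderiv ℝ ηs p (Pi.single i 1, 0, 0, 0)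
         = -(2 * ηx i p)))
    ↔
    (∃ f₁ : ℝ → ℝ, ∃ f₂ : ((Fin n₀ → ℝ) × ℝ × ℝ) → ℝ,
      ∃ h : Fin n₀ → ((Fin n₀ → ℝ) × ℝ × ℝ) → ℝ,
      ContDiff ℝ (⊤ : ℕ∞) f₁ ∧ ContDiff ℝ (⊤ : ℕ∞) f₂ ∧
      (∀ i, ContDiff ℝ (⊤ : ℕ∞) (h i)) ∧
      (∀ (i : Fin n₀) q, fderiv ℝ (h i) q (0, 1, 0) + 2 * h i q
          = fderiv ℝ f₂ q (Pi.single i 1, 0, 0)) ∧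
      (∀ (x : Fin n₀ → ℝ) (t s u : ℝ), ηt (x, t, s, u) = f₁ u) ∧
      (∀ (x : Fin n₀ → ℝ) (t s u : ℝ), ηs (x, t, s, u) = 2 * t * f₁ u + f₂ (x, s, u)) ∧
      (∀ (i : Fin n₀) (x : Fin n₀ → ℝ) (t s u : ℝ), ηx i (x, t, s, u) = h i (x, s, u))) := by
  have dηt := hηt.differentiable (by simp)
  have dηs := hηs.differentiable (by simp)
  have dηx := fun i => (hηx i).differentiable (by simp)
  constructor
  · rintro ⟨htt, hts, htx, hxt, hst, hxs⟩
    have hconst : ∀ (x : Fin n₀ → ℝ) (t s u : ℝ), ηt (x, t, s, u) = ηt (0, 0, 0, u) := by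
      intro x t s u
      have h := eq_add_mul_of_fderiv_line dηt (0, 0, 0, u) (x, t, s, 0) 0
        (fun r => apply_eq_zero_of_coordinates _ (htt _) (hts _) (fun i => htx i _) x t s) 1
      simpa using h
    refine ⟨fun u => ηt (lastInclusion _ u), fun q => ηs (zeroTimeInclusion _ q),
      fun i q => ηx i (zeroTimeInclusion _ q), hηt.comp (lastInclusion (Fin n₀ → ℝ)).contDiff,
      hηs.comp (zeroTimeInclusion (Fin n₀ → ℝ)).contDiff,
      fun i => (hηx i).comp (zeroTimeInclusion (Fin n₀ → ℝ)).contDiff, ?_, hconst, ?_, ?_⟩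
    · intro i q
      rw [fderiv_comp_clm_apply (dηx i), fderiv_comp_clm_apply dηs]
      have h := hxs i (zeroTimeInclusion _ q)
      simp only [zeroTimeInclusion, ContinuousLinearMap.prod_apply, ContinuousLinearMap.coe_fst',
        ContinuousLinearMap.coe_snd', zero_apply] at h ⊢
      linarith
    · intro x t s u
      have h := eq_add_mul_of_fderiv_line dηs (x, 0, s, u) (0, 1, 0, 0) (2 * ηt (0, 0, 0, u))
        (fun r => by rw [hst]; exact congrArg (2 * ·) (by simpa using hconst x r s u)) t
      simp at h
      simp [lastInclusion, zeroTimeInclusion, h]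
      ring
    · intro i x t s u
      have h := eq_add_mul_of_fderiv_line (dηx i) (x, 0, s, u) (0, 1, 0, 0) 0
        (fun r => hxt i _) t
      simpa [zeroTimeInclusion] using h
  · rintro ⟨f₁, f₂, h, hf₁, hf₂, hh, hode, et, es, ex⟩
    have df₁ := hf₁.differentiable (by simp)
    have df₂ := hf₂.differentiable (by simp)
    have dh := fun i => (hh i).differentiable (by simp)
    have hηt_eq : ηt = fun p => f₁ (lastCoord _ p) := funext fun p => et p.1 p.2.1 p.2.2.1 p.2.2.2
    have hηx_eq : ∀ i, ηx i = fun p => h i (forgetTime _ p) :=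
      fun i => funext fun p => ex i p.1 p.2.1 p.2.2.1 p.2.2.2
    have hηs_eq : ηs = fun p => 2 * timeCoord _ p * f₁ (lastCoord _ p) + f₂ (forgetTime _ p) :=
      funext fun p => es p.1 p.2.1 p.2.2.1 p.2.2.2
    have hfηs : ∀ p v, lastCoord _ v = 0 → fderiv ℝ ηs p v
        = 2 * timeCoord _ v * f₁ (lastCoord _ p)
          + fderiv ℝ f₂ (forgetTime _ p) (forgetTime _ v) := by
      intro p v hv
      have h₁ : HasFDerivAt (fun p => 2 * timeCoord (Fin n₀ → ℝ) p) _ p :=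
        (timeCoord (Fin n₀ → ℝ)).hasFDerivAt.const_mul (2 : ℝ)
      have h₂ : HasFDerivAt (fun p => f₁ (lastCoord (Fin n₀ → ℝ) p)) _ p :=
        (df₁ _).hasFDerivAt.comp p (lastCoord (Fin n₀ → ℝ)).hasFDerivAt
      have h₃ : HasFDerivAt (fun p => f₂ (forgetTime (Fin n₀ → ℝ) p)) _ p :=
        (df₂ _).hasFDerivAt.comp p (forgetTime (Fin n₀ → ℝ)).hasFDerivAt
      rw [hηs_eq]
      refine (DFunLike.congr_fun ((h₁.mul h₂).add h₃).fderiv v).trans ?_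
      simp [-fderiv_eq_smul_deriv, hv]
      ring
    refine ⟨?_, ?_, ?_, ?_, ?_, ?_⟩
    · intro p
      rw [hηt_eq, fderiv_comp_clm_apply df₁]
      exact map_zero _
    · intro p
      rw [hηt_eq, fderiv_comp_clm_apply df₁]
      exact map_zero _
    · intro i p
      rw [hηt_eq, fderiv_comp_clm_apply df₁]
      exact map_zero _
    · intro i p
      rw [hηx_eq, fderiv_comp_clm_apply (dh i)]
      exact map_zero _
    · intro p
      have hz : forgetTime (Fin n₀ → ℝ) (0, 1, 0, 0) = 0 := rfl
      have h1 : timeCoord (Fin n₀ → ℝ) (0, 1, 0, 0) = 1 := rfl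
      rw [hfηs p _ rfl, hz, h1, map_zero, hηt_eq]
      ring
    · intro i p
      have hz : timeCoord (Fin n₀ → ℝ) (Pi.single i 1, 0, 0, 0) = 0 := rfl
      have h1 : forgetTime (Fin n₀ → ℝ) (0, 0, 1, 0) = (0, 1, 0) := rfl
      have h2 : forgetTime (Fin n₀ → ℝ) (Pi.single i 1, 0, 0, 0) = (Pi.single i 1, 0, 0) := rfl
      rw [hfηs p _ rfl, hz, h2, hηx_eq, fderiv_comp_clm_apply (dh i), h1,
        ← hode i (forgetTime _ p)]
      ring
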